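/- Let $C_s$ be the $s$-cut operator of a nonnegative natural partition system $(Z, A_1, \dots, A_N)$ at radius $r$ with impurity parameter $\zeta_s = 1 - \gamma - g(r) - 2h(r)Z^{\leq s}(r) \geq 0$ and $\gamma = \sum_i \gamma_i$. Then $C_s$ maps the simplex $H = \{x \in \mathbb{R}^N : x_i \geq 0, \sum_i x_i = 1\}$ into itself; consequently, by the Brouwer fixed point theorem, $C_s$ has a fixed point in $H$. -/

import Mathlib

/-- The `s`-cut operator of a natural partition system, expressed via the real
values `G i j = g_{ij}(r)`, `Hc i j k = h_{ijk}(r)`, `hr = h(r)`,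
`Av j = A_j^{≤s}(r)`, the constants `γi i = γ_i`, and `ζ = ζ_s`. -/
def sCutOp {N : ℕ} (G : Fin N → Fin N → ℝ) (Hc : Fin N → Fin N → Fin N → ℝ)
    (hr : ℝ) (Av : Fin N → ℝ) (γi : Fin N → ℝ) (ζ : ℝ)
    (x : Fin N → ℝ) : Fin N → ℝ := fun i =>
  γi i + ∑ j, G i j * x j
    + ∑ j, ∑ k, hr * Hc i j k * (Av j * x k + Av k * x j)
    + ∑ j, ∑ k, ζ * Hc i j k * x j * x k

/-- The standard simplex. -/
def simplexH (N : ℕ) : Set (Fin N → ℝ) :=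
  {x | (∀ i, 0 ≤ x i) ∧ ∑ i, x i = 1}

section Scarf

open Finset

variable {I T α : Type*} [LinearOrder α]

/-- With respect to the rankings `p i` of `T`, the pair `(σ, C)` is dominant if every point of `T`
lies weakly below all of `σ` in at least one of the rankings indexed by `C`. -/
def IsDominant (p : I → T → α) (σ : Finset T) (C : Finset I) : Prop :=
  ∀ y, ∃ i ∈ C, ∀ x ∈ σ, p i y ≤ p i x

theorem IsDominant.mono {p : I → T → α} {σ τ : Finset T} {C D : Finset I}
    (h : IsDominant p σ C) (hτ : τ ⊆ σ) (hD : C ⊆ D) : IsDominant p τ D := fun y => by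
  obtain ⟨i, hi, hy⟩ := h y
  exact ⟨i, hD hi, fun x hx => hy x (hτ hx)⟩

/-- In a dominant pair with `#σ = #C`, distinct rankings in `C` have distinct minimizers on `σ`. -/
theorem IsDominant.index_unique {p : I → T → α} (hp : ∀ i, Function.Injective (p i))
    {σ : Finset T} {C : Finset I} (h : IsDominant p σ C) (hcard : #σ = #C) {i j : I}
    (hi : i ∈ C) (hj : j ∈ C) {z : T} (hz : z ∈ σ) (hzi : ∀ x ∈ σ, p i z ≤ p i x)
    (hzj : ∀ x ∈ σ, p j z ≤ p j x) : i = j := by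
  choose m hm hmin using fun i => σ.exists_min_image (p i) ⟨z, hz⟩
  have key : ∀ k w, w ∈ σ → (∀ x ∈ σ, p k w ≤ p k x) → m k = w := fun k w hw hk =>
    hp k (le_antisymm (hmin k w hw) (hk _ (hm k)))
  have hsurj : Set.SurjOn m C σ := fun w hw => by
    obtain ⟨k, hk, hkw⟩ := h w
    exact ⟨k, hk, key k w hw hkw⟩
  have hinj := Finset.injOn_of_surjOn_of_card_le m (fun k _ => hm k) hsurj hcard.ge
  exact hinj hi hj ((key i z hz hzi).trans (key j z hz hzj).symm)

open Classical in
/-- The dominant pairs `(σ, C)` with `#σ = #C`. -/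
noncomputable def dominantRooms [Fintype I] [Fintype T] (p : I → T → α) : Finset (Finset T × Finset I) :=
  univ.filter fun r => IsDominant p r.1 r.2 ∧ #r.1 = #r.2

theorem mem_dominantRooms [Fintype I] [Fintype T] {p : I → T → α} {r : Finset T × Finset I} :
    r ∈ dominantRooms p ↔ IsDominant p r.1 r.2 ∧ #r.1 = #r.2 := by
  simp [dominantRooms]

variable [DecidableEq I] [DecidableEq T]

/-- The two ways of enlarging `(τ, D)` to a pair with `#σ = #C` by giving up the index `i`: either
`i` is removed from `D`, or a point that is dominated by no index other than `i` joins `τ`. -/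
def IsExtension (p : I → T → α) (τ : Finset T) (D : Finset I) (i : I)
    (r : Finset T × Finset I) : Prop :=
  r = (τ, D.erase i) ∨
    ∃ x ∉ τ, r = (insert x τ, D) ∧ ∀ j ∈ D, j ≠ i → ∃ z ∈ τ, p j z < p j x

theorem IsDominant.existsUnique_extension [Fintype T] {p : I → T → α}
    (hp : ∀ i, Function.Injective (p i)) {τ : Finset T} {D : Finset I} (h : IsDominant p τ D)
    {i : I} (hi : i ∈ D)
    (hS : ∀ z ∈ τ, ∃ j ∈ D, j ≠ i ∧ ∀ x ∈ τ, p j z ≤ p j x) :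
    ∃! r : Finset T × Finset I, IsDominant p r.1 r.2 ∧ IsExtension p τ D i r := by
  classical
  by_cases hd : IsDominant p τ (D.erase i)
  · refine ⟨_, ⟨hd, Or.inl rfl⟩, ?_⟩
    rintro r ⟨-, rfl | ⟨x, -, -, hx⟩⟩
    · rfl
    · obtain ⟨j, hj, hjx⟩ := hd x
      obtain ⟨z, hz, hlt⟩ := hx j (mem_of_mem_erase hj) (ne_of_mem_erase hj)
      exact absurd (hjx z hz) hlt.not_ge
  · set M : Finset T := univ.filter fun x => ∀ j ∈ D, j ≠ i → ∃ z ∈ τ, p j z < p j x with hM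
    have hne : M.Nonempty := by
      simp only [IsDominant, not_forall, not_exists, not_and, not_le] at hd
      obtain ⟨y, hy⟩ := hd
      refine ⟨y, mem_filter.2 ⟨mem_univ _, fun j hj hji => ?_⟩⟩
      obtain ⟨z, hz, hlt⟩ := hy j (mem_erase.2 ⟨hji, hj⟩)
      exact ⟨z, hz, hlt⟩
    obtain ⟨x, hxM, hmax⟩ := M.exists_max_image (p i) hne
    have hx := (mem_filter.1 hxM).2
    have hxτ : x ∉ τ := fun hxτ => by
      obtain ⟨j, hj, hji, hle⟩ := hS x hxτ
      obtain ⟨z, hz, hlt⟩ := hx j hj hji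
      exact (hle z hz).not_gt hlt
    refine ⟨(insert x τ, D), ⟨fun y => ?_, Or.inr ⟨x, hxτ, rfl, hx⟩⟩, ?_⟩
    · by_cases hy : y ∈ M
      · obtain ⟨j, hj, hle⟩ := h y
        have hji : j = i := by
          by_contra hji
          obtain ⟨z, hz, hlt⟩ := (mem_filter.1 hy).2 j hj hji
          exact (hle z hz).not_gt hlt
        subst hji
        exact ⟨j, hj, forall_mem_insert _ _ _ |>.2 ⟨hmax y hy, hle⟩⟩
      · simp only [hM, mem_filter, mem_univ, true_and, not_forall, not_exists, not_and,
          not_lt] at hy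
        obtain ⟨j, hj, hji, hle⟩ := hy
        obtain ⟨z, hz, hlt⟩ := hx j hj hji
        exact ⟨j, hj, forall_mem_insert _ _ _ |>.2 ⟨(hle z hz).trans hlt.le, hle⟩⟩
    · rintro r ⟨hr, rfl | ⟨x', -, rfl, hx'⟩⟩
      · exact absurd hr hd
      · have hx'M : x' ∈ M := mem_filter.2 ⟨mem_univ _, hx'⟩
        obtain ⟨j, hj, hle⟩ := hr x
        have hji : j = i := by
          by_contra hji
          obtain ⟨z, hz, hlt⟩ := hx j hj hji
          exact (hle z (mem_insert_of_mem hz)).not_gt hlt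
        subst hji
        rw [hp j (le_antisymm (hmax x' hx'M) (hle x' (mem_insert_self _ _)))]

/-- Pairs `(σ, C)` with `#σ = #C` lying above `(τ, D)`, where `#D = #τ + 1`. -/
theorem eq_or_eq_of_card_eq {τ σ : Finset T} {D C : Finset I} (hD : #D = #τ + 1) (hτ : τ ⊆ σ)
    (hC : C ⊆ D) (hcard : #σ = #C) :
    (σ = τ ∧ ∃ i ∈ D, C = D.erase i) ∨ (C = D ∧ ∃ x ∉ τ, σ = insert x τ) := by
  have h1 := card_le_card hτ
  have h2 := card_le_card hC
  rcases h1.eq_or_lt with h | h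
  · refine Or.inl ⟨(eq_of_subset_of_card_le hτ h.ge).symm, ?_⟩
    obtain ⟨i, hi, rfl⟩ := (covBy_iff_card_sdiff_eq_one.2
      ⟨hC, by rw [card_sdiff_of_subset hC]; omega⟩).exists_finset_erase
    exact ⟨i, hi, rfl⟩
  · refine Or.inr ⟨eq_of_subset_of_card_le hC (by omega), ?_⟩
    obtain ⟨x, hx, rfl⟩ := (covBy_iff_card_sdiff_eq_one.2
      ⟨hτ, by rw [card_sdiff_of_subset hτ]; omega⟩).exists_finset_insert
    exact ⟨x, hx, rfl⟩

/-- If `#σ = #C` but `c` does not map `σ` onto `C`, an even number of subsets `τ` of `σ` are mapped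
by `c` injectively to sets that avoid `i₀` and cover `C` after adding `i₀`. -/
theorem even_card_doors (c : T → I) (i₀ : I) {σ : Finset T} {C : Finset I} (hcard : #σ = #C)
    (hne : σ.image c ≠ C) (S : Finset (Finset T))
    (hS : ∀ τ, τ ∈ S ↔ (Set.InjOn c τ ∧ i₀ ∉ τ.image c) ∧ τ ⊆ σ ∧ C ⊆ insert i₀ (τ.image c)) :
    Even #S := by
  have hcases : ∀ τ ∈ S, τ = σ ∨ ∃ x ∈ σ, τ = σ.erase x := fun τ hτ => by
    obtain ⟨⟨hinj, hi⟩, hsub, hC⟩ := (hS τ).1 hτ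
    have h1 : #(insert i₀ (τ.image c)) = #τ + 1 := by
      rw [card_insert_of_notMem hi, card_image_of_injOn hinj]
    rcases eq_or_eq_of_card_eq h1 hsub hC hcard with ⟨h, -⟩ | ⟨-, x, hx, h⟩
    · exact Or.inl h.symm
    · exact Or.inr ⟨x, h ▸ mem_insert_self x τ, by rw [h, erase_insert hx]⟩
  rcases S.eq_empty_or_nonempty with rfl | ⟨τ₀, hτ₀⟩
  · simp
  by_cases hinj : Set.InjOn c σ
  · have hi₀ : i₀ ∉ σ.image c := fun hmem => by
      obtain ⟨x, hx, hxi⟩ := mem_image.1 hmem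
      obtain ⟨⟨-, hi⟩, hsub, hC⟩ := (hS τ₀).1 hτ₀
      refine hne (eq_of_subset_of_card_le (hC.trans (insert_subset hmem (image_subset_image hsub)))
        ?_).symm
      rw [card_image_of_injOn hinj, hcard]
    have hCsub : C ⊆ insert i₀ (σ.image c) := by
      obtain ⟨-, hsub, hC⟩ := (hS τ₀).1 hτ₀
      exact hC.trans (insert_subset_insert _ (image_subset_image hsub))
    have hσ : σ ∈ S := (hS σ).2 ⟨⟨hinj, hi₀⟩, Subset.rfl, hCsub⟩
    have h1 : #(insert i₀ (σ.image c)) = #σ + 1 := by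
      rw [card_insert_of_notMem hi₀, card_image_of_injOn hinj]
    obtain ⟨k, hk, hCk⟩ : ∃ k ∈ insert i₀ (σ.image c), C = (insert i₀ (σ.image c)).erase k := by
      rcases eq_or_eq_of_card_eq h1 Subset.rfl hCsub hcard with ⟨-, h⟩ | ⟨-, x, hx, h⟩
      · exact h
      · exact absurd (h ▸ mem_insert_self x σ) hx
    have hki : k ≠ i₀ := by
      rintro rfl
      exact hne (by rw [hCk, erase_insert hi₀])
    obtain ⟨x, hx, rfl⟩ := mem_image.1 ((mem_insert.1 hk).resolve_left hki)
    have himage : ∀ y ∈ σ, (σ.erase y).image c = (σ.image c).erase (c y) := fun y hy => by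
      ext j
      simp only [mem_image, mem_erase]
      constructor
      · rintro ⟨z, ⟨hzy, hz⟩, rfl⟩
        exact ⟨fun h => hzy (hinj hz hy h), z, hz, rfl⟩
      · rintro ⟨hj, z, hz, rfl⟩
        exact ⟨z, ⟨fun h => hj (h ▸ rfl), hz⟩, rfl⟩
    have hx' : σ.erase x ∈ S := by
      refine (hS _).2 ⟨⟨hinj.mono (by simp), fun h => hi₀ ?_⟩, erase_subset _ _, ?_⟩
      · exact image_subset_image (erase_subset _ _) h
      · rw [himage x hx, hCk, erase_insert_of_ne hki.symm]
    suffices S = {σ, σ.erase x} by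
      rw [this, card_pair fun h : σ = σ.erase x => notMem_erase x σ (h.subset hx)]
      exact even_two
    ext τ
    rw [mem_insert, mem_singleton]
    refine ⟨fun hτ => ?_, by rintro (rfl | rfl) <;> assumption⟩
    refine (hcases τ hτ).imp_right ?_
    rintro ⟨y, hy, rfl⟩
    obtain ⟨-, -, hC⟩ := (hS _).1 hτ
    by_contra hxy
    have hyx : y ≠ x := fun h => hxy (h ▸ rfl)
    have hcy : c y ∈ C := by
      rw [hCk]
      exact mem_erase.2 ⟨fun h => hyx (hinj hy hx h), mem_insert_of_mem (mem_image_of_mem c hy)⟩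
    have := hC hcy
    rw [himage y hy, mem_insert] at this
    rcases this with h | h
    · exact hi₀ (h ▸ mem_image_of_mem c hy)
    · exact notMem_erase _ _ h
  · obtain ⟨x, hx, y, hy, hcxy, hxy⟩ : ∃ x ∈ σ, ∃ y ∈ σ, c x = c y ∧ x ≠ y := by
      simpa [Set.InjOn] using hinj
    have hcases' : ∀ τ ∈ S, τ = σ.erase x ∨ τ = σ.erase y := fun τ hτ => by
      obtain ⟨⟨hinjτ, -⟩, -, -⟩ := (hS τ).1 hτ
      rcases hcases τ hτ with rfl | ⟨z, hz, rfl⟩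
      · exact absurd hinjτ hinj
      · by_contra! hcon
        have hzx : x ≠ z := fun h => hcon.1 (h ▸ rfl)
        have hzy : y ≠ z := fun h => hcon.2 (h ▸ rfl)
        exact hxy (hinjτ (by simp [hx, hzx]) (by simp [hy, hzy]) hcxy)
    have himage : ∀ u v, u ∈ σ → v ∈ σ → u ≠ v → c u = c v →
        (σ.erase u).image c = σ.image c := fun u v hu hv huv hcuv => by
      refine (image_subset_image (erase_subset _ _)).antisymm fun j hj => ?_
      obtain ⟨z, hz, rfl⟩ := mem_image.1 hj
      by_cases hzu : z = u
      · exact mem_image.2 ⟨v, mem_erase.2 ⟨huv.symm, hv⟩, by rw [hzu, hcuv]⟩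
      · exact mem_image_of_mem c (mem_erase.2 ⟨hzu, hz⟩)
    have hex := himage x y hx hy hxy hcxy
    have hey := himage y x hy hx hxy.symm hcxy.symm
    have hcarde : #(σ.erase x) = #(σ.erase y) := by
      rw [card_erase_of_mem hx, card_erase_of_mem hy]
    have hiff : σ.erase x ∈ S ↔ σ.erase y ∈ S := by
      simp only [hS, hex, hey, ← card_image_iff, hcarde, erase_subset, true_and]
    have hboth : σ.erase x ∈ S ∧ σ.erase y ∈ S := by
      rcases hcases' τ₀ hτ₀ with h | h
      · exact ⟨h ▸ hτ₀, hiff.1 (h ▸ hτ₀)⟩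
      · exact ⟨hiff.2 (h ▸ hτ₀), h ▸ hτ₀⟩
    suffices S = {σ.erase x, σ.erase y} by
      rw [this, card_pair fun h : σ.erase x = σ.erase y =>
        notMem_erase x σ (h.symm.subset (mem_erase.2 ⟨hxy, hx⟩))]
      exact even_two
    ext τ
    rw [mem_insert, mem_singleton]
    refine ⟨hcases' τ, ?_⟩
    rintro (rfl | rfl)
    exacts [hboth.1, hboth.2]

variable [Fintype T] [Fintype I]

theorem IsExtension.mem_filter_dominantRooms {p : I → T → α} {τ : Finset T} {D : Finset I} {i : I}
    {r : Finset T × Finset I} (hD : #D = #τ + 1) (hi : i ∈ D) (h : IsExtension p τ D i r)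
    (hr : IsDominant p r.1 r.2) :
    r ∈ (dominantRooms p).filter fun r => τ ⊆ r.1 ∧ r.2 ⊆ D := by
  rw [mem_filter, mem_dominantRooms]
  rcases h with rfl | ⟨x, hx, rfl, -⟩
  · exact ⟨⟨hr, by simp [card_erase_of_mem hi, hD]⟩, Subset.rfl, erase_subset _ _⟩
  · exact ⟨⟨hr, by simp [card_insert_of_notMem hx, hD]⟩, subset_insert _ _, Subset.rfl⟩

theorem card_rooms_of_empty [Nonempty T] {p : I → T → α} (hp : ∀ i, Function.Injective (p i))
    (i : I) (h : IsDominant p (∅ : Finset T) {i}) :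
    #((dominantRooms p).filter fun r => (∅ : Finset T) ⊆ r.1 ∧ r.2 ⊆ {i}) = 1 := by
  obtain ⟨r, ⟨hr, hext⟩, huniq⟩ := h.existsUnique_extension hp (mem_singleton_self i) (by simp)
  refine card_eq_one.2 ⟨r, eq_singleton_iff_unique_mem.2
    ⟨hext.mem_filter_dominantRooms (by simp) (mem_singleton_self i) hr, fun s hs => ?_⟩⟩
  obtain ⟨hs, hτ, hD⟩ := mem_filter.1 hs
  obtain ⟨hs, hcard⟩ := mem_dominantRooms.1 hs
  refine huniq s ⟨hs, ?_⟩
  rcases eq_or_eq_of_card_eq (by simp) hτ hD hcard with ⟨h1, j, hj, h2⟩ | ⟨h1, x, hx, h2⟩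
  · rw [mem_singleton.1 hj] at h2
    exact Or.inl (Prod.ext h1 h2)
  · exact Or.inr ⟨x, hx, Prod.ext h2 h1, fun j hj hji => absurd (mem_singleton.1 hj) hji⟩

theorem card_rooms_of_nonempty {p : I → T → α} (hp : ∀ i, Function.Injective (p i))
    {τ : Finset T} {D : Finset I} (hτ : τ.Nonempty) (hD : #D = #τ + 1) (h : IsDominant p τ D) :
    #((dominantRooms p).filter fun r => τ ⊆ r.1 ∧ r.2 ⊆ D) = 2 := by
  choose m hm hmin using fun i => τ.exists_min_image (p i) hτ
  obtain ⟨a, ha, b, hb, hab, hmab⟩ :=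
    exists_ne_map_eq_of_card_lt_of_maps_to (s := D) (t := τ) (by omega) (fun i _ => hm i)
  have hsurj : ∀ z ∈ τ, ∃ j ∈ D, m j = z := fun z hz => by
    obtain ⟨j, hj, hle⟩ := h z
    exact ⟨j, hj, hp j (le_antisymm (hmin j z hz) (hle _ (hm j)))⟩
  have hSa : ∀ z ∈ τ, ∃ j ∈ D, j ≠ a ∧ ∀ x ∈ τ, p j z ≤ p j x := fun z hz => by
    obtain ⟨j, hj, rfl⟩ := hsurj z hz
    by_cases hja : j = a
    · exact ⟨b, hb, hab.symm, by rw [hja, hmab]; exact hmin b⟩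
    · exact ⟨j, hj, hja, hmin j⟩
  have hSb : ∀ z ∈ τ, ∃ j ∈ D, j ≠ b ∧ ∀ x ∈ τ, p j z ≤ p j x := fun z hz => by
    obtain ⟨j, hj, rfl⟩ := hsurj z hz
    by_cases hjb : j = b
    · exact ⟨a, ha, hab, by rw [hjb, ← hmab]; exact hmin a⟩
    · exact ⟨j, hj, hjb, hmin j⟩
  obtain ⟨ra, ⟨hra, hexta⟩, hua⟩ := h.existsUnique_extension hp ha hSa
  obtain ⟨rb, ⟨hrb, hextb⟩, hub⟩ := h.existsUnique_extension hp hb hSb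
  refine card_eq_two.2 ⟨ra, rb, ?_, ?_⟩
  · rintro rfl
    rcases hexta with rfl | ⟨x, hx, rfl, hxa⟩ <;> rcases hextb with h' | ⟨y, hy, h', hyb⟩
    · exact notMem_erase b D ((Prod.mk.inj h').2 ▸ mem_erase.2 ⟨hab.symm, hb⟩)
    · exact hy ((Prod.mk.inj h').1.symm.subset (mem_insert_self y τ))
    · exact hx ((Prod.mk.inj h').1.subset (mem_insert_self x τ))
    · have hxy : x = y := by
        have : x ∈ insert y τ := (Prod.mk.inj h').1.subset (mem_insert_self x τ)
        exact (mem_insert.1 this).resolve_right hx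
      subst hxy
      obtain ⟨j, hj, hle⟩ := h x
      by_cases hja : j = a
      · obtain ⟨z, hz, hlt⟩ := hyb j hj (hja ▸ hab)
        exact (hle z hz).not_gt hlt
      · obtain ⟨z, hz, hlt⟩ := hxa j hj hja
        exact (hle z hz).not_gt hlt
  · ext s
    rw [mem_insert, mem_singleton]
    constructor
    · intro hs
      obtain ⟨σ, C⟩ := s
      obtain ⟨hroom, hτs, hDs⟩ := mem_filter.1 hs
      clear hs
      obtain ⟨hs, hcard⟩ := mem_dominantRooms.1 hroom
      dsimp only at hs hcard hτs hDs
      rcases eq_or_eq_of_card_eq hD hτs hDs hcard with ⟨rfl, j, hj, rfl⟩ | ⟨rfl, x, hx, rfl⟩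
      · by_cases hja : j = a
        · exact Or.inl (hua _ ⟨hs, Or.inl (by rw [hja])⟩)
        by_cases hjb : j = b
        · exact Or.inr (hub _ ⟨hs, Or.inl (by rw [hjb])⟩)
        · exact absurd (hs.index_unique hp hcard (mem_erase.2 ⟨Ne.symm hja, ha⟩)
            (mem_erase.2 ⟨Ne.symm hjb, hb⟩) (hm a) (hmin a) (hmab ▸ hmin b)) hab
      · obtain ⟨i, hi, hle⟩ := hs x
        have hother : ∀ j ∈ C, j ≠ i → ∃ z ∈ τ, p j z < p j x := fun j hj hji => by
          by_contra! hcon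
          exact hji (hs.index_unique hp hcard hj hi (mem_insert_self x τ)
            (forall_mem_insert _ _ _ |>.2 ⟨le_rfl, hcon⟩) hle)
        have hmin' : ∀ j ∈ C, j ≠ i → ∀ y ∈ insert x τ, p j (m j) ≤ p j y := fun j hj hji => by
          obtain ⟨z, hz, hlt⟩ := hother j hj hji
          exact forall_mem_insert _ _ _ |>.2 ⟨(hmin j z hz).trans hlt.le, hmin j⟩
        by_cases hia : i = a
        · exact Or.inl (hua _ ⟨hs, Or.inr ⟨x, hx, rfl, hia ▸ hother⟩⟩)
        by_cases hib : i = b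
        · exact Or.inr (hub _ ⟨hs, Or.inr ⟨x, hx, rfl, hib ▸ hother⟩⟩)
        · exact absurd (hs.index_unique hp hcard ha hb (mem_insert_of_mem (hm a))
            (hmin' a ha (Ne.symm hia)) (hmab ▸ hmin' b hb (Ne.symm hib))) hab
    · rintro (rfl | rfl)
      · exact hexta.mem_filter_dominantRooms hD ha hra
      · exact hextb.mem_filter_dominantRooms hD hb hrb

/-- Scarf's lemma: for every colouring of a finite set by the index set of a family of rankings,
some dominant pair `(σ, C)` has `C` as its set of colours. -/
theorem exists_isDominant_image_eq [Nonempty T] {p : I → T → α}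
    (hp : ∀ i, Function.Injective (p i)) (c : T → I) :
    ∃ σ : Finset T, IsDominant p σ (σ.image c) := by
  classical
  by_contra! hcon
  obtain ⟨i₀⟩ : Nonempty I := ‹Nonempty T›.map c
  let doors : Finset (Finset T) := univ.filter fun τ =>
    (Set.InjOn c τ ∧ i₀ ∉ τ.image c) ∧ IsDominant p τ (insert i₀ (τ.image c))
  let inc : Finset T → Finset T × Finset I → Prop := fun τ r =>
    τ ⊆ r.1 ∧ r.2 ⊆ insert i₀ (τ.image c)
  have hcount := sum_card_bipartiteAbove_eq_sum_card_bipartiteBelow inc (s := doors)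
    (t := dominantRooms p)
  have heven : Even (∑ r ∈ dominantRooms p, #(bipartiteBelow inc doors r)) := by
    refine even_sum _ fun r hr => ?_
    obtain ⟨hdom, hcard⟩ := mem_dominantRooms.1 hr
    refine even_card_doors c i₀ hcard (fun h => hcon r.1 (h ▸ hdom)) _ fun τ => ?_
    simp only [bipartiteBelow, doors, inc, mem_filter, mem_univ, true_and]
    exact ⟨fun h => ⟨h.1.1, h.2⟩, fun h => ⟨⟨h.1, hdom.mono h.2.1 h.2.2⟩, h.2⟩⟩
  have hdom₀ : IsDominant p (∅ : Finset T) {i₀} := fun y => ⟨i₀, by simp, by simp⟩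
  have hmem₀ : ∅ ∈ doors := by simpa [doors] using hdom₀
  have hone : #(bipartiteAbove inc (dominantRooms p) ∅) = 1 := by
    simpa [bipartiteAbove, inc] using card_rooms_of_empty hp i₀ hdom₀
  have hodd : Odd (∑ τ ∈ doors, #(bipartiteAbove inc (dominantRooms p) τ)) := by
    rw [← add_sum_erase _ _ hmem₀, hone]
    refine odd_one.add_even (even_sum _ fun τ hτ => ?_)
    obtain ⟨hτ, hτd⟩ := mem_erase.1 hτ
    obtain ⟨⟨hinj, hi⟩, hdom⟩ := (mem_filter.1 hτd).2
    rw [show #(bipartiteAbove inc (dominantRooms p) τ) = 2 from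
      card_rooms_of_nonempty hp (nonempty_iff_ne_empty.2 hτ)
        (by rw [card_insert_of_notMem hi, card_image_of_injOn hinj]) hdom]
    exact even_two
  rw [hcount] at hodd
  exact Nat.not_even_iff_odd.2 hodd heven

end Scarf

section Brouwer

open Finset

/-- A Sperner-type lemma on the lattice points of a dilated simplex: for every colouring there is a
lattice point `x` such that each colour either belongs to a vanishing coordinate or is taken near
`x`, up to an error bounded by the dimension. -/
theorem exists_lattice_point_near_colours {N : ℕ} (hN : 0 < N) (k : ℕ)
    (c : (Fin N → ℕ) → Fin N) :
    ∃ x : Fin N → ℕ, ∑ i, x i = k ∧ ∀ i, x i ≤ N ∨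
      ∃ y : Fin N → ℕ, ∑ j, y j = k ∧ c y = i ∧ ∀ j, x j ≤ y j + N ∧ y j ≤ x j + N := by
  classical
  let T := {x : Fin N → ℕ // x ∈ piAntidiag univ k}
  have : Fintype T := FinsetCoe.fintype _
  have hT : ∀ x : T, ∑ i, x.1 i = k := fun x => by simpa using (mem_piAntidiag.1 x.2).1
  have hmk : ∀ x : Fin N → ℕ, ∑ i, x i = k → x ∈ piAntidiag univ k := fun x hx => by
    simpa using hx
  have : Nonempty T := ⟨⟨Pi.single ⟨0, hN⟩ k, hmk _ (by simp)⟩⟩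
  let p : Fin N → T → ℕ ×ₗ Fin (Fintype.card T) := fun i x =>
    toLex (x.1 i, Fintype.equivFin T x)
  have hp : ∀ i, Function.Injective (p i) := fun i x y h => by
    have := congrArg (fun q => (ofLex q).2) h
    exact (Fintype.equivFin T).injective this
  have hple : ∀ i x y, p i x ≤ p i y → x.1 i ≤ y.1 i := fun i x y h => by
    rcases (Prod.Lex.le_iff).1 h with h | h
    · exact h.le
    · exact h.1.le
  obtain ⟨σ, hσ⟩ := exists_isDominant_image_eq hp (fun x : T => c x.1)
  set C := σ.image fun x : T => c x.1 with hC
  obtain ⟨i₁, hi₁, -⟩ := hσ (Classical.arbitrary T)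
  obtain ⟨x₀, hx₀, -⟩ := mem_image.1 hi₁
  choose m hm hmin using fun i => σ.exists_min_image (fun x : T => x.1 i) ⟨x₀, hx₀⟩
  have hbound : k < ∑ i ∈ C, ((m i).1 i + 1) := by
    by_contra! hle
    let f : Fin N → ℕ := fun i => if i ∈ C then (m i).1 i + 1 else 0
    have hf : ∑ i, f i = ∑ i ∈ C, ((m i).1 i + 1) := by simp [f, sum_ite_mem]
    let y : Fin N → ℕ := f + Pi.single i₁ (k - ∑ i ∈ C, ((m i).1 i + 1))
    have hy : ∑ i, y i = k := by
      simp only [y, Pi.add_apply]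
      rw [sum_add_distrib, hf, sum_pi_single', if_pos (mem_univ _)]
      omega
    obtain ⟨i, hi, hyi⟩ := hσ ⟨y, hmk y hy⟩
    have h1 : y i ≤ (m i).1 i := hple i _ _ (hyi (m i) (hm i))
    have h2 : f i ≤ y i := by simp [y]
    simp only [f, if_pos hi] at h2
    omega
  have hcardC : #C ≤ N := by simpa using card_le_univ C
  rw [sum_add_distrib, sum_const, smul_eq_mul, mul_one] at hbound
  have hsplit : ∀ x ∈ σ, ∑ i ∈ C, x.1 i + ∑ i ∈ Cᶜ, x.1 i = k := fun x _ => by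
    rw [sum_add_sum_compl, hT]
  have hminsum : ∀ x ∈ σ, ∑ i ∈ C, (m i).1 i ≤ ∑ i ∈ C, x.1 i := fun x hx =>
    sum_le_sum fun i _ => hmin i x hx
  have hout : ∀ x ∈ σ, ∀ j ∉ C, x.1 j ≤ N := fun x hx j hj => by
    have h1 := hsplit x hx
    have h2 := hminsum x hx
    have h3 : x.1 j ≤ ∑ i ∈ Cᶜ, x.1 i :=
      single_le_sum (f := x.1) (fun i _ => Nat.zero_le _) (mem_compl.2 hj)
    omega
  have hin : ∀ x ∈ σ, ∀ j ∈ C, x.1 j ≤ (m j).1 j + N := fun x hx j hj => by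
    have h1 := hsplit x hx
    have h2 : ∑ i ∈ C.erase j, (m i).1 i ≤ ∑ i ∈ C.erase j, x.1 i :=
      sum_le_sum fun i _ => hmin i x hx
    have h3 := add_sum_erase C (fun i => (m i).1 i) hj
    have h4 := add_sum_erase C x.1 hj
    omega
  have hclose : ∀ x ∈ σ, ∀ y ∈ σ, ∀ j, x.1 j ≤ y.1 j + N := fun x hx y hy j => by
    by_cases hj : j ∈ C
    · exact (hin x hx j hj).trans (Nat.add_le_add_right (hmin j y hy) N)
    · exact (hout x hx j hj).trans (Nat.le_add_left N _)
  refine ⟨x₀.1, hT x₀, fun i => ?_⟩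
  by_cases hi : i ∈ C
  · obtain ⟨y, hy, hyi⟩ := mem_image.1 hi
    exact Or.inr ⟨y.1, hT y, hyi, fun j => ⟨hclose x₀ hx₀ y hy j, hclose y hy x₀ hx₀ j⟩⟩
  · exact Or.inl (hout x₀ hx₀ i hi)

theorem exists_approx_fixedPoint_stdSimplex {N : ℕ} (hN : 0 < N)
    {F : (Fin N → ℝ) → Fin N → ℝ} (hF : ContinuousOn F (stdSimplex ℝ (Fin N)))
    (hmaps : Set.MapsTo F (stdSimplex ℝ (Fin N)) (stdSimplex ℝ (Fin N))) {ε : ℝ} (hε : 0 < ε) :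
    ∃ x ∈ stdSimplex ℝ (Fin N), ∀ i, x i - ε ≤ F x i := by
  have huc := (isCompact_stdSimplex ℝ (Fin N)).uniformContinuousOn_of_continuous hF
  obtain ⟨δ, hδ, hFδ⟩ := Metric.uniformContinuousOn_iff.1 huc (ε / 2) (half_pos hε)
  obtain ⟨k, hk⟩ := exists_nat_gt (max (N / δ) (N / (ε / 2)))
  have hN' : (0 : ℝ) < N := by exact_mod_cast hN
  have hk0 : (0 : ℝ) < k := lt_of_le_of_lt (le_max_of_le_left (by positivity)) hk
  have hkδ : (N : ℝ) / k < δ := by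
    have := (le_max_left _ _).trans_lt hk
    rw [div_lt_iff₀ hδ] at this
    rw [div_lt_iff₀ hk0]
    linarith
  have hkε : (N : ℝ) / k < ε / 2 := by
    have := (le_max_right _ _).trans_lt hk
    rw [div_lt_iff₀ (half_pos hε)] at this
    rw [div_lt_iff₀ hk0]
    linarith
  let e : (Fin N → ℕ) → Fin N → ℝ := fun x i => x i / k
  have he : ∀ x : Fin N → ℕ, ∑ i, x i = k → e x ∈ stdSimplex ℝ (Fin N) := fun x hx => by
    refine ⟨fun i => by positivity, ?_⟩
    simp only [e]
    rw [← sum_div, ← Nat.cast_sum, hx, div_self hk0.ne']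
  have hcol : ∀ x : Fin N → ℕ, ∃ i, ∑ i, x i = k → e x i ≤ F (e x) i := fun x => by
    by_contra! hcon
    have hx := (hcon ⟨0, hN⟩).1
    have hlt : ∑ i, F (e x) i < ∑ i, e x i :=
      sum_lt_sum_of_nonempty ⟨⟨0, hN⟩, mem_univ _⟩ fun i _ => (hcon i).2
    rw [(he x hx).2, (hmaps (he x hx)).2] at hlt
    exact lt_irrefl _ hlt
  choose c hc using hcol
  obtain ⟨x, hx, hnear⟩ := exists_lattice_point_near_colours hN k c
  refine ⟨e x, he x hx, fun i => ?_⟩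
  rcases hnear i with hi | ⟨y, hy, hcy, hxy⟩
  · have h1 : e x i ≤ N / k := by
      have : (x i : ℝ) ≤ N := by exact_mod_cast hi
      exact div_le_div_of_nonneg_right this hk0.le
    have h2 := (hmaps (he x hx)).1 i
    linarith
  · have habs : ∀ j, |e x j - e y j| ≤ N / k := fun j => by
      have h1 : (x j : ℝ) ≤ y j + N := by exact_mod_cast (hxy j).1
      have h2 : (y j : ℝ) ≤ x j + N := by exact_mod_cast (hxy j).2
      simp only [e]
      rw [← sub_div, abs_div, abs_of_pos hk0]
      exact div_le_div_of_nonneg_right (abs_le.2 ⟨by linarith, by linarith⟩) hk0.le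
    have hdist : dist (e x) (e y) < δ :=
      ((dist_pi_le_iff (by positivity)).2 fun j => by
        rw [Real.dist_eq]; exact habs j).trans_lt hkδ
    have hFd := (dist_le_pi_dist (F (e x)) (F (e y)) i).trans_lt
      (hFδ _ (he x hx) _ (he y hy) hdist)
    rw [Real.dist_eq] at hFd
    have h1 := hc y hy
    rw [hcy] at h1
    have h2 := abs_le.1 (habs i)
    have h3 := abs_lt.1 hFd
    linarith [h2.1, h2.2, h3.1, h3.2]

/-- Brouwer's fixed point theorem for the standard simplex. -/
theorem exists_fixedPoint_stdSimplex {N : ℕ} (hN : 0 < N)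
    {F : (Fin N → ℝ) → Fin N → ℝ} (hF : ContinuousOn F (stdSimplex ℝ (Fin N)))
    (hmaps : Set.MapsTo F (stdSimplex ℝ (Fin N)) (stdSimplex ℝ (Fin N))) :
    ∃ x ∈ stdSimplex ℝ (Fin N), F x = x := by
  choose u hu hle using fun n : ℕ =>
    exists_approx_fixedPoint_stdSimplex hN hF hmaps (Nat.one_div_pos_of_nat (α := ℝ) (n := n))
  obtain ⟨x, hx, φ, hφ, hlim⟩ := (isCompact_stdSimplex ℝ (Fin N)).tendsto_subseq hu
  have hFlim : Filter.Tendsto (fun n => F (u (φ n))) Filter.atTop (nhds (F x)) :=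
    (hF x hx).tendsto.comp
      (tendsto_nhdsWithin_iff.2 ⟨hlim, Filter.Eventually.of_forall fun n => hu (φ n)⟩)
  have hxF : ∀ i, x i ≤ F x i := fun i => by
    have h1 := ((tendsto_pi_nhds.1 hlim) i).sub
      (tendsto_one_div_add_atTop_nhds_zero_nat (𝕜 := ℝ) |>.comp hφ.tendsto_atTop)
    rw [sub_zero] at h1
    exact le_of_tendsto_of_tendsto' h1 ((tendsto_pi_nhds.1 hFlim) i) fun n => hle (φ n) i
  refine ⟨x, hx, funext fun i => ?_⟩
  have hsum : ∑ i, x i = ∑ i, F x i := by rw [hx.2, (hmaps hx).2]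
  exact ((sum_eq_sum_iff_of_le fun i _ => hxF i).1 hsum i (mem_univ i)).symm

end Brouwer

/-- If each symmetrized pair of `h` sums to `2`, then `h` integrates symmetric arrays like the
constant `1`. -/
theorem sum_mul_symm_eq {N : ℕ} (Hc : Fin N → Fin N → Fin N → ℝ)
    (hsym : ∀ j k, ∑ i, (Hc i j k + Hc i k j) = 2) (w : Fin N → Fin N → ℝ)
    (hw : ∀ j k, w j k = w k j) :
    ∑ i, ∑ j, ∑ k, Hc i j k * w j k = ∑ j, ∑ k, w j k := by
  have h1 : ∑ i, ∑ j, ∑ k, Hc i j k * w j k = ∑ j, ∑ k, (∑ i, Hc i j k) * w j k := by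
    rw [Finset.sum_comm]
    refine Finset.sum_congr rfl fun j _ => ?_
    rw [Finset.sum_comm]
    simp only [Finset.sum_mul]
  have h2 : ∑ j, ∑ k, (∑ i, Hc i j k) * w j k = ∑ j, ∑ k, (∑ i, Hc i k j) * w j k := by
    rw [Finset.sum_comm]
    exact Finset.sum_congr rfl fun j _ => Finset.sum_congr rfl fun k _ => by rw [hw]
  have h3 : ∑ j, ∑ k, (∑ i, Hc i j k) * w j k + ∑ j, ∑ k, (∑ i, Hc i k j) * w j k
      = 2 * ∑ j, ∑ k, w j k := by
    simp only [← Finset.sum_add_distrib, ← add_mul, hsym, Finset.mul_sum]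
  linarith

theorem sum_sCutOp {N : ℕ}
    (G : Fin N → Fin N → ℝ) (Hc : Fin N → Fin N → Fin N → ℝ)
    (hr : ℝ) (Av : Fin N → ℝ) (γi : Fin N → ℝ) (ζ gr : ℝ)
    (hcol : ∀ j, ∑ i, G i j = gr)
    (hsym : ∀ j k, ∑ i, (Hc i j k + Hc i k j) = 2) (x : Fin N → ℝ) :
    ∑ i, sCutOp G Hc hr Av γi ζ x i = (∑ i, γi i) + gr * (∑ i, x i)
      + 2 * hr * (∑ j, Av j) * (∑ i, x i) + ζ * (∑ i, x i) ^ 2 := by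
  have hg : ∑ i, ∑ j, G i j * x j = gr * ∑ i, x i := by
    rw [Finset.sum_comm, Finset.mul_sum]
    simp only [← Finset.sum_mul, hcol]
  have hlin : ∑ i, ∑ j, ∑ k, hr * Hc i j k * (Av j * x k + Av k * x j)
      = 2 * hr * (∑ j, Av j) * (∑ i, x i) := by
    have h := sum_mul_symm_eq Hc hsym (fun j k => hr * (Av j * x k + Av k * x j))
      (fun j k => by ring)
    have h' : ∑ j, ∑ k, hr * (Av j * x k + Av k * x j) = 2 * hr * (∑ j, Av j) * (∑ i, x i) := by
      simp only [← Finset.mul_sum, Finset.sum_add_distrib, ← Finset.sum_mul]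
      ring
    rw [← h', ← h]
    exact Finset.sum_congr rfl fun i _ => Finset.sum_congr rfl fun j _ =>
      Finset.sum_congr rfl fun k _ => by ring
  have hquad : ∑ i, ∑ j, ∑ k, ζ * Hc i j k * x j * x k = ζ * (∑ i, x i) ^ 2 := by
    have h := sum_mul_symm_eq Hc hsym (fun j k => ζ * (x j * x k)) (fun j k => by ring)
    have h' : ∑ j, ∑ k, ζ * (x j * x k) = ζ * (∑ i, x i) ^ 2 := by
      simp only [← Finset.mul_sum, ← Finset.sum_mul]
      ring
    rw [← h', ← h]
    exact Finset.sum_congr rfl fun i _ => Finset.sum_congr rfl fun j _ =>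
      Finset.sum_congr rfl fun k _ => by ring
  rw [← hg, ← hlin, ← hquad]
  simp only [sCutOp, Finset.sum_add_distrib]

theorem sCut_maps_simplex_and_has_fixed_point (N : ℕ) (hN : 0 < N)
    (G : Fin N → Fin N → ℝ) (Hc : Fin N → Fin N → Fin N → ℝ)
    (hr : ℝ) (Av : Fin N → ℝ) (γi : Fin N → ℝ) (ζ gr : ℝ)
    (hG : ∀ i j, 0 ≤ G i j) (hHc : ∀ i j k, 0 ≤ Hc i j k)
    (hhr : 0 ≤ hr) (hAv : ∀ j, 0 ≤ Av j) (hγi : ∀ i, 0 ≤ γi i) (hζ : 0 ≤ ζ)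
    (hcol : ∀ j, ∑ i, G i j = gr)
    (hsym : ∀ j k, ∑ i, (Hc i j k + Hc i k j) = 2)
    (hnorm : (∑ i, γi i) + gr + 2 * hr * (∑ j, Av j) + ζ = 1) :
    (∀ x ∈ simplexH N, sCutOp G Hc hr Av γi ζ x ∈ simplexH N) ∧
    (∃ x ∈ simplexH N, sCutOp G Hc hr Av γi ζ x = x) := by
  have hmaps : ∀ x ∈ simplexH N, sCutOp G Hc hr Av γi ζ x ∈ simplexH N := by
    rintro x ⟨hx0, hx1⟩
    refine ⟨fun i => ?_, ?_⟩
    · refine add_nonneg (add_nonneg (add_nonneg (hγi i) ?_) ?_) ?_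
      · exact Finset.sum_nonneg fun j _ => mul_nonneg (hG i j) (hx0 j)
      · exact Finset.sum_nonneg fun j _ => Finset.sum_nonneg fun k _ =>
          mul_nonneg (mul_nonneg hhr (hHc i j k))
            (add_nonneg (mul_nonneg (hAv j) (hx0 k)) (mul_nonneg (hAv k) (hx0 j)))
      · exact Finset.sum_nonneg fun j _ => Finset.sum_nonneg fun k _ =>
          mul_nonneg (mul_nonneg (mul_nonneg hζ (hHc i j k)) (hx0 j)) (hx0 k)
    · rw [sum_sCutOp G Hc hr Av γi ζ gr hcol hsym, hx1]
      linarith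
  refine ⟨hmaps, exists_fixedPoint_stdSimplex hN (Continuous.continuousOn ?_) hmaps⟩
  unfold sCutOp
  fun_prop
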